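/- Let g(y) = 𝔞·(e^{βy} − 1) on ℕ with 𝔞, β > 0, let p = 1, let θ, σ be real numbers with σ = θ − β (here Z(θ) < ∞ for all θ), and let μ̂ = μ^σ. Then the single-shock measure ν_j satisfies the random walking shock property with rates P = (e^{β} − 1)·(e^σ + 𝔞) and Q = 0, i.e. for every bounded cylinder function φ, ∫Lφ dν_j = (e^β − 1)(e^σ + 𝔞)·(∫φ dν_{j+1} − ∫φ dν_j). -/

import Mathlib

open MeasureTheory Real

noncomputable def gfact (g : ℕ → ℝ) (z : ℕ) : ℝ := ∏ y ∈ Finset.Icc 1 z, g y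

noncomputable def ZN (g : ℕ → ℝ) (θ : ℝ) : ℝ := ∑' z : ℕ, exp (θ * z) / gfact g z

noncomputable def muN (g : ℕ → ℝ) (θ : ℝ) (z : ℕ) : ℝ := exp (θ * z) / (gfact g z * ZN g θ)

abbrev ConfN : Type := ℤ → ℕ

/-- The configuration with one particle moved from site `i` to site `j`. -/
def moveN (η : ConfN) (i j : ℤ) : ConfN :=
  fun k => if k = i then η k - 1 else if k = j then η k + 1 else η k

/-- The coupled zero range generator with right-jump probability `p` and rate function `g`,
acting on functions of the coupled pair of configurations. -/
noncomputable def LN (p : ℝ) (g : ℕ → ℝ) (φ : ConfN × ConfN → ℝ) (x : ConfN × ConfN) : ℝ :=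
  ∑' i : ℤ,
    (p * g (x.1 i) * (φ (moveN x.1 i (i + 1), moveN x.2 i (i + 1)) - φ x)
      + p * (g (x.2 i) - g (x.1 i)) * (φ (x.1, moveN x.2 i (i + 1)) - φ x)
      + (1 - p) * g (x.1 i) * (φ (moveN x.1 i (i - 1), moveN x.2 i (i - 1)) - φ x)
      + (1 - p) * (g (x.2 i) - g (x.1 i)) * (φ (x.1, moveN x.2 i (i - 1)) - φ x))

/-- A bounded cylinder function: bounded and depending on finitely many coordinates. -/
def IsBddCylinder (φ : ConfN × ConfN → ℝ) : Prop :=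
  (∃ s : Finset ℤ, ∀ x y : ConfN × ConfN,
      (∀ i ∈ s, x.1 i = y.1 i ∧ x.2 i = y.2 i) → φ x = φ y)
    ∧ ∃ C : ℝ, ∀ x, |φ x| ≤ C

/-- The discrete measure on ℕ × ℕ with mass function `f`. -/
noncomputable def siteMeasure (f : ℕ × ℕ → ℝ) : Measure (ℕ × ℕ) :=
  Measure.count.withDensity fun yz => ENNReal.ofReal (f yz)

/-- `ν` is the product measure on `(ℕ × ℕ)^ℤ` with the given site marginals:
every cylinder event has product probability. -/
def IsProductMeasure (fac : ℤ → Measure (ℕ × ℕ)) (ν : Measure (ConfN × ConfN)) : Prop :=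
  ∀ (s : Finset ℤ) (B : ℤ → Set (ℕ × ℕ)),
    ν {x : ConfN × ConfN | ∀ i ∈ s, (x.1 i, x.2 i) ∈ B i} = ∏ i ∈ s, fac i (B i)

/-- The site marginals of the single-shock measure `ν_j`: the image of `μ^θ` under
`y ↦ (y,y)` for `i < j`, the image of `μ̂` under `y ↦ (y,y+1)` at `i = j`, and the image of
`μ^σ` under `y ↦ (y,y)` for `i > j`. -/
noncomputable def shockFactor (g : ℕ → ℝ) (θ σ : ℝ) (μhat : ℕ → ℝ) (j i : ℤ) :
    Measure (ℕ × ℕ) :=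
  if i < j then siteMeasure fun yz => if yz.2 = yz.1 then muN g θ yz.1 else 0
  else if i = j then siteMeasure fun yz => if yz.2 = yz.1 + 1 then μhat yz.1 else 0
  else siteMeasure fun yz => if yz.2 = yz.1 then muN g σ yz.1 else 0

section ZRPaux
open Filter Topology

theorem gfact_succ (g : ℕ → ℝ) (z : ℕ) : gfact g (z+1) = gfact g z * g (z+1) := by
  unfold gfact
  rw [Finset.prod_Icc_succ_top (by omega)]

/-- The exponential rate. -/
structure ExpRate (𝔞 β : ℝ) (g : ℕ → ℝ) : Prop where
  ha : 0 < 𝔞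
  hb : 0 < β
  hg : ∀ y : ℕ, g y = 𝔞 * (exp (β * y) - 1)

variable {𝔞 β : ℝ} {g : ℕ → ℝ}

theorem ExpRate.zero (h : ExpRate 𝔞 β g) : g 0 = 0 := by simp [h.hg]

theorem ExpRate.pos (h : ExpRate 𝔞 β g) (z : ℕ) : 0 < g (z+1) := by
  rw [h.hg]
  refine mul_pos h.ha ?_
  have : 0 < β * ((z+1 : ℕ) : ℝ) := mul_pos h.hb (by positivity)
  have := Real.add_one_lt_exp this.ne'
  linarith

theorem ExpRate.nonneg (h : ExpRate 𝔞 β g) (z : ℕ) : 0 ≤ g z := by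
  cases z with
  | zero => rw [h.zero]
  | succ n => exact (h.pos n).le

theorem ExpRate.fact_pos (h : ExpRate 𝔞 β g) (z : ℕ) : 0 < gfact g z := by
  induction z with
  | zero => simp [gfact]
  | succ n ih => rw [gfact_succ]; exact mul_pos ih (h.pos n)

theorem ExpRate.tendsto (h : ExpRate 𝔞 β g) : Tendsto (fun n : ℕ => g (n+1)) atTop atTop := by
  have h1 : Tendsto (fun n : ℕ => 𝔞 * (β * ((n+1 : ℕ) : ℝ))) atTop atTop := by
    refine Tendsto.const_mul_atTop h.ha (Tendsto.const_mul_atTop h.hb ?_)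
    exact tendsto_natCast_atTop_atTop.comp (tendsto_add_atTop_nat 1)
  refine tendsto_atTop_mono (fun n => ?_) h1
  rw [h.hg]
  refine mul_le_mul_of_nonneg_left ?_ h.ha.le
  have := Real.add_one_le_exp (β * ((n+1 : ℕ) : ℝ))
  linarith

theorem ExpRate.summable (h : ExpRate 𝔞 β g) (θ : ℝ) :
    Summable (fun z : ℕ => exp (θ * z) / gfact g z) := by
  refine summable_of_ratio_test_tendsto_lt_one (l := 0) zero_lt_one ?_ ?_
  · exact Eventually.of_forall fun n => (div_pos (exp_pos _) (h.fact_pos n)).ne'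
  · have h2 : Tendsto (fun n : ℕ => exp θ * (g (n+1))⁻¹) atTop (𝓝 0) := by
      simpa using (h.tendsto.inv_tendsto_atTop).const_mul (exp θ)
    refine h2.congr fun n => ?_
    have p1 := h.fact_pos n
    have p2 := h.pos n
    rw [Real.norm_of_nonneg (div_pos (exp_pos _) (h.fact_pos _)).le,
      Real.norm_of_nonneg (div_pos (exp_pos _) (h.fact_pos _)).le, gfact_succ]
    push_cast
    rw [mul_add, mul_one, exp_add]
    field_simp

theorem ExpRate.Z_pos (h : ExpRate 𝔞 β g) (θ : ℝ) : 0 < ZN g θ :=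
  (h.summable θ).tsum_pos (fun n => (div_pos (exp_pos _) (h.fact_pos n)).le) 0
    (div_pos (exp_pos _) (h.fact_pos 0))

theorem ExpRate.mu_pos (h : ExpRate 𝔞 β g) (θ : ℝ) (z : ℕ) : 0 < muN g θ z :=
  div_pos (exp_pos _) (mul_pos (h.fact_pos z) (h.Z_pos θ))

theorem ExpRate.mu_hasSum (h : ExpRate 𝔞 β g) (θ : ℝ) : HasSum (muN g θ) 1 := by
  have := (h.summable θ).hasSum.div_const (ZN g θ)
  rw [← ZN, div_self (h.Z_pos θ).ne'] at this
  simpa [muN, div_div] using! this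

theorem ExpRate.mu_succ (h : ExpRate 𝔞 β g) (θ : ℝ) (z : ℕ) :
    muN g θ (z+1) * g (z+1) = exp θ * muN g θ z := by
  have p1 := h.fact_pos z
  have p2 := h.pos z
  have p3 := h.Z_pos θ
  unfold muN
  rw [gfact_succ]
  push_cast
  rw [mul_add, mul_one, exp_add]
  field_simp

theorem ExpRate.summable_mu_g (h : ExpRate 𝔞 β g) (θ : ℝ) :
    Summable (fun z => muN g θ z * g z) := by
  rw [← summable_nat_add_iff 1]
  simp_rw [h.mu_succ]
  exact (h.mu_hasSum θ).summable.mul_left _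

theorem ExpRate.tsum_mu_g (h : ExpRate 𝔞 β g) (θ : ℝ) :
    ∑' z, muN g θ z * g z = exp θ := by
  rw [(h.summable_mu_g θ).tsum_eq_zero_add]
  simp_rw [h.mu_succ]
  rw [tsum_mul_left, (h.mu_hasSum θ).tsum_eq, h.zero]
  simp

theorem ExpRate.exp_eq (h : ExpRate 𝔞 β g) (z : ℕ) : 𝔞 * exp (β * z) = g z + 𝔞 := by
  rw [h.hg]; ring

theorem ExpRate.mu_theta (h : ExpRate 𝔞 β g) {θ σ : ℝ} (hσ : σ = θ - β) (z : ℕ) :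
    muN g σ z * (g z + 𝔞) = (exp σ + 𝔞) * muN g θ z := by
  have key : ∀ z, muN g σ z * (g z + 𝔞) = (𝔞 * ZN g θ / ZN g σ) * muN g θ z := by
    intro z
    have p1 := h.fact_pos z
    have p2 := h.Z_pos θ
    have p3 := h.Z_pos σ
    rw [← h.exp_eq]
    have : exp (θ * z) = exp (σ * z) * exp (β * z) := by
      rw [← exp_add]; congr 1; rw [hσ]; ring
    unfold muN
    rw [this]
    field_simp
  have s1 : ∑' z, muN g σ z * (g z + 𝔞) = exp σ + 𝔞 := by
    simp_rw [mul_add]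
    rw [(h.summable_mu_g σ).tsum_add ((h.mu_hasSum σ).summable.mul_right _), h.tsum_mu_g,
      tsum_mul_right, (h.mu_hasSum σ).tsum_eq, one_mul]
  have s2 : ∑' z, muN g σ z * (g z + 𝔞) = 𝔞 * ZN g θ / ZN g σ := by
    simp_rw [key]
    rw [tsum_mul_left, (h.mu_hasSum θ).tsum_eq, mul_one]
  rw [key, ← s2, s1]

/-- The single-site measure. -/
noncomputable def siteM (g : ℕ → ℝ) (θ : ℝ) : Measure ℕ :=
  Measure.count.withDensity fun z => ENNReal.ofReal (muN g θ z)

theorem siteM_singleton (g : ℕ → ℝ) (θ : ℝ) (z : ℕ) :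
    siteM g θ {z} = ENNReal.ofReal (muN g θ z) := by
  rw [siteM, withDensity_apply _ (measurableSet_singleton z)]
  simp

theorem ExpRate.prob (h : ExpRate 𝔞 β g) (θ : ℝ) : IsProbabilityMeasure (siteM g θ) := by
  constructor
  rw [siteM, withDensity_apply _ MeasurableSet.univ, Measure.restrict_univ, lintegral_count,
    ← ENNReal.ofReal_tsum_of_nonneg (fun z => (h.mu_pos θ z).le) (h.mu_hasSum θ).summable,
    (h.mu_hasSum θ).tsum_eq, ENNReal.ofReal_one]

theorem ExpRate.integrable_iff (h : ExpRate 𝔞 β g) (θ : ℝ) (f : ℕ → ℝ) :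
    Integrable f (siteM g θ) ↔ Summable (fun z => muN g θ z * f z) := by
  rw [siteM, integrable_withDensity_iff_integrable_smul' (by fun_prop) (by simp),
    integrable_count_iff]
  simp only [ENNReal.toReal_ofReal (h.mu_pos θ _).le, smul_eq_mul]
  exact summable_norm_iff

theorem ExpRate.integral_eq (h : ExpRate 𝔞 β g) (θ : ℝ) (f : ℕ → ℝ)
    (hf : Integrable f (siteM g θ)) :
    ∫ z, f z ∂(siteM g θ) = ∑' z, muN g θ z * f z := by
  rw [integral_countable hf]
  simp [Measure.real, siteM_singleton, ENNReal.toReal_ofReal (h.mu_pos θ _).le]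

theorem ExpRate.integrable_g (h : ExpRate 𝔞 β g) (θ : ℝ) : Integrable g (siteM g θ) :=
  (h.integrable_iff θ g).2 (h.summable_mu_g θ)

theorem ExpRate.integrable_bdd (h : ExpRate 𝔞 β g) (θ : ℝ) (f : ℕ → ℝ) (C : ℝ)
    (hC : ∀ y, |f y| ≤ C) : Integrable f (siteM g θ) := by
  have := h.prob θ
  exact Integrable.of_bound (by fun_prop) C (Eventually.of_forall hC)

theorem ExpRate.integrable_g_mul (h : ExpRate 𝔞 β g) (θ : ℝ) (f : ℕ → ℝ) (C : ℝ)
    (hC : ∀ y, |f y| ≤ C) : Integrable (fun y => g y * f y) (siteM g θ) :=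
  (h.integrable_g θ).mul_bdd (c := C) (by fun_prop) (Eventually.of_forall hC)

theorem ExpRate.site_g (h : ExpRate 𝔞 β g) (θ : ℝ) (f : ℕ → ℝ) (C : ℝ)
    (hC : ∀ y, |f y| ≤ C) :
    ∫ y, g y * f y ∂(siteM g θ) = exp θ * ∫ y, f (y+1) ∂(siteM g θ) := by
  have i1 := h.integrable_g_mul θ f C hC
  have i2 := h.integrable_bdd θ (fun y => f (y+1)) C (fun y => hC _)
  rw [h.integral_eq θ _ i1, h.integral_eq θ _ i2,
    ((h.integrable_iff θ _).1 i1).tsum_eq_zero_add, h.zero, ← tsum_mul_left]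
  simp only [zero_mul, mul_zero, zero_add]
  refine tsum_congr fun z => ?_
  rw [← mul_assoc, h.mu_succ]; ring

theorem ExpRate.site_theta (h : ExpRate 𝔞 β g) {θ σ : ℝ} (hσ : σ = θ - β) (f : ℕ → ℝ) (C : ℝ)
    (hC : ∀ y, |f y| ≤ C) :
    ∫ y, (g y + 𝔞) * f y ∂(siteM g σ) = (exp σ + 𝔞) * ∫ y, f y ∂(siteM g θ) := by
  have i1 := (h.integrable_g_mul σ f C hC).add ((h.integrable_bdd σ f C hC).const_mul 𝔞)
  have i1' : Integrable (fun y => (g y + 𝔞) * f y) (siteM g σ) := by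
    refine i1.congr (Eventually.of_forall fun y => ?_)
    simp [add_mul]
  rw [h.integral_eq σ _ i1', h.integral_eq θ _ (h.integrable_bdd θ f C hC), ← tsum_mul_left]
  refine tsum_congr fun z => ?_
  rw [← mul_assoc, h.mu_theta hσ]; ring

theorem infinitePi_update (μ : ℤ → Measure ℕ) [∀ i, IsProbabilityMeasure (μ i)] (i : ℤ)
    (ρ : Measure ℕ) [IsProbabilityMeasure ρ] (μ' : ℤ → Measure ℕ)
    [∀ i, IsProbabilityMeasure (μ' i)] (h1 : μ' i = ρ) (h2 : ∀ k, k ≠ i → μ' k = μ k) :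
    ((Measure.infinitePi μ).prod ρ).map (fun q : ConfN × ℕ => Function.update q.1 i q.2)
      = Measure.infinitePi μ' := by
  refine Measure.eq_infinitePi _ fun s t ht => ?_
  rw [Measure.map_apply (by fun_prop) (MeasurableSet.pi s.countable_toSet fun i _ => ht i)]
  have hpre : (fun q : ConfN × ℕ => Function.update q.1 i q.2) ⁻¹' (Set.pi (↑s) t)
      = (Set.pi (↑(s.erase i)) t) ×ˢ (if i ∈ s then t i else Set.univ) := by
    ext ⟨ω, y⟩
    simp only [Set.mem_preimage, Set.mem_pi, Finset.mem_coe, Set.mem_prod, Finset.mem_erase]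
    constructor
    · intro h
      refine ⟨fun k hk => ?_, ?_⟩
      · have := h k hk.2
        rwa [Function.update_of_ne hk.1] at this
      · split_ifs with hi
        · simpa using h i hi
        · trivial
    · rintro ⟨h, h'⟩ k hk
      by_cases hki : k = i
      · subst hki; simpa [hk] using h'
      · rw [Function.update_of_ne hki]; exact h k ⟨hki, hk⟩
  rw [hpre, Measure.prod_prod, Measure.infinitePi_pi _ (fun i _ => ht i)]
  have e1 : ∏ k ∈ s.erase i, μ k (t k) = ∏ k ∈ s.erase i, μ' k (t k) :=
    Finset.prod_congr rfl fun k hk => by rw [h2 k (Finset.ne_of_mem_erase hk)]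
  rw [e1]
  by_cases hi : i ∈ s
  · rw [if_pos hi, ← h1, Finset.prod_erase_mul _ _ hi]
  · rw [if_neg hi, measure_univ, mul_one, Finset.erase_eq_of_notMem hi]

/-- One more particle at site `i`. -/
def inc (ω : ConfN) (i : ℤ) : ConfN := Function.update ω i (ω i + 1)

@[fun_prop]
theorem measurable_inc (i : ℤ) : Measurable (fun ω : ConfN => inc ω i) := by
  unfold inc; fun_prop

theorem measurable_moveN (i j : ℤ) : Measurable (fun ω : ConfN => moveN ω i j) := by
  unfold moveN
  refine measurable_pi_lambda _ fun k => ?_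
  split_ifs
  · exact (measurable_of_countable (fun n : ℕ => n - 1)).comp (measurable_pi_apply k)
  · exact (measurable_of_countable (fun n : ℕ => n + 1)).comp (measurable_pi_apply k)
  · exact measurable_pi_apply k

theorem moveN_inc (ω : ConfN) (i j : ℤ) (hij : j ≠ i) : moveN (inc ω i) i j = inc ω j := by
  funext k
  unfold moveN inc
  by_cases h1 : k = i
  · subst h1; simp [Function.update_of_ne hij.symm]
  · by_cases h2 : k = j
    · subst h2; simp [h1]
    · simp [h1, h2]

/-- A site-swap of integrals: resampling coordinate `i`. -/
theorem integral_resample (μ : ℤ → Measure ℕ) [∀ i, IsProbabilityMeasure (μ i)] (i : ℤ)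
    (ρ : Measure ℕ) [IsProbabilityMeasure ρ] (μ' : ℤ → Measure ℕ)
    [∀ i, IsProbabilityMeasure (μ' i)] (h1 : μ' i = ρ) (h2 : ∀ k, k ≠ i → μ' k = μ k)
    (F : ConfN → ℝ) (hF : Integrable F (Measure.infinitePi μ')) :
    ∫ ω, F ω ∂(Measure.infinitePi μ')
      = ∫ ω, ∫ y, F (Function.update ω i y) ∂ρ ∂(Measure.infinitePi μ) := by
  rw [← infinitePi_update μ i ρ μ' h1 h2] at hF ⊢
  have hm : Measurable (fun q : ConfN × ℕ => Function.update q.1 i q.2) := by fun_prop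
  rw [integral_map hm.aemeasurable hF.aestronglyMeasurable]
  rw [integral_prod]
  exact (integrable_map_measure hF.aestronglyMeasurable hm.aemeasurable).1 hF

/-- The base factors: parameter θ left of j, σ from j on. -/
noncomputable def baseM (g : ℕ → ℝ) (θ σ : ℝ) (j : ℤ) (i : ℤ) : Measure ℕ :=
  siteM g (if i < j then θ else σ)

theorem ExpRate.prob_base (h : ExpRate 𝔞 β g) (θ σ : ℝ) (j i : ℤ) :
    IsProbabilityMeasure (baseM g θ σ j i) := h.prob _

/-- The base product measure. -/
noncomputable def baseP (g : ℕ → ℝ) (θ σ : ℝ) (j : ℤ) : Measure ConfN :=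
  Measure.infinitePi (baseM g θ σ j)

theorem ExpRate.prob_baseP (h : ExpRate 𝔞 β g) (θ σ : ℝ) (j : ℤ) :
    IsProbabilityMeasure (baseP g θ σ j) := by
  have := h.prob_base θ σ j
  unfold baseP; infer_instance

theorem ExpRate.base_integrable_bdd (h : ExpRate 𝔞 β g) (θ σ : ℝ) (j : ℤ)
    (F : ConfN → ℝ) (hF : Measurable F) (C : ℝ) (hC : ∀ ω, |F ω| ≤ C) :
    Integrable F (baseP g θ σ j) := by
  have := h.prob_baseP θ σ j
  exact Integrable.of_bound hF.aestronglyMeasurable C (Eventually.of_forall hC)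

theorem ExpRate.base_integrable_g (h : ExpRate 𝔞 β g) (θ σ : ℝ) (j i : ℤ)
    (F : ConfN → ℝ) (hF : Measurable F) (C : ℝ) (hC : ∀ ω, |F ω| ≤ C) :
    Integrable (fun ω => g (ω i) * F ω) (baseP g θ σ j) := by
  have := h.prob_base θ σ j
  have hmp := measurePreserving_eval_infinitePi (baseM g θ σ j) i
  have : Integrable (fun ω : ConfN => g (ω i)) (baseP g θ σ j) :=
    hmp.integrable_comp_of_integrable (h.integrable_g _)
  exact this.mul_bdd (c := C) hF.aestronglyMeasurable (Eventually.of_forall hC)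

theorem ExpRate.base_g (h : ExpRate 𝔞 β g) (θ σ : ℝ) (j i : ℤ)
    (F : ConfN → ℝ) (hF : Measurable F) (C : ℝ) (hC : ∀ ω, |F ω| ≤ C) :
    ∫ ω, g (ω i) * F ω ∂(baseP g θ σ j)
      = exp (if i < j then θ else σ) * ∫ ω, F (inc ω i) ∂(baseP g θ σ j) := by
  have := h.prob_base θ σ j
  have i1 := h.base_integrable_g θ σ j i F hF C hC
  have i2 := h.base_integrable_bdd θ σ j (fun ω => F (inc ω i)) (hF.comp (measurable_inc i)) C
    (fun ω => hC _)
  unfold baseP at *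
  rw [integral_resample (baseM g θ σ j) i (baseM g θ σ j i) _ rfl (fun _ _ => rfl) _ i1,
    integral_resample (baseM g θ σ j) i (baseM g θ σ j i) _ rfl (fun _ _ => rfl) _ i2,
    ← integral_const_mul]
  refine integral_congr_ae (Eventually.of_forall fun ω => ?_)
  simp only [Function.update_self, inc, Function.update_idem]
  exact h.site_g _ (fun y => F (Function.update ω i y)) C (fun y => hC _)

theorem ExpRate.base_theta (h : ExpRate 𝔞 β g) {θ σ : ℝ} (hσ : σ = θ - β) (j : ℤ)
    (F : ConfN → ℝ) (hF : Measurable F) (C : ℝ) (hC : ∀ ω, |F ω| ≤ C) :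
    ∫ ω, (g (ω j) + 𝔞) * F ω ∂(baseP g θ σ j)
      = (exp σ + 𝔞) * ∫ ω, F ω ∂(baseP g θ σ (j+1)) := by
  have := h.prob_base θ σ j
  have := h.prob_base θ σ (j+1)
  have := h.prob θ
  have i1 : Integrable (fun ω => (g (ω j) + 𝔞) * F ω) (baseP g θ σ j) := by
    refine ((h.base_integrable_g θ σ j j F hF C hC).add
      ((h.base_integrable_bdd θ σ j F hF C hC).const_mul 𝔞)).congr
      (Eventually.of_forall fun y => ?_)
    simp [add_mul]
  have i2 := h.base_integrable_bdd θ σ (j+1) F hF C hC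
  unfold baseP at *
  rw [integral_resample (baseM g θ σ j) j (baseM g θ σ j j) _ rfl (fun _ _ => rfl) _ i1,
    integral_resample (baseM g θ σ j) j (siteM g θ) _ (by simp [baseM]) ?_ _ i2,
    ← integral_const_mul]
  · refine integral_congr_ae (Eventually.of_forall fun ω => ?_)
    simp only [Function.update_self]
    have := h.site_theta hσ (fun y => F (Function.update ω j y)) C (fun y => hC _)
    simpa [baseM] using this
  · intro k hk
    have : k < j + 1 ↔ k < j := by omega
    simp [baseM, this]

/-- `siteMeasure` of a graph is the image of the site measure. -/
theorem siteMeasure_graph (m : ℕ → ℝ) (f : ℕ → ℕ) :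
    siteMeasure (fun yz => if yz.2 = f yz.1 then m yz.1 else 0)
      = (Measure.count.withDensity fun z => ENNReal.ofReal (m z)).map (fun y => (y, f y)) := by
  refine Measure.ext_of_singleton fun ⟨a, b⟩ => ?_
  rw [Measure.map_apply (measurable_of_countable _) (measurableSet_singleton _), siteMeasure,
    withDensity_apply _ (measurableSet_singleton _), withDensity_apply _ (by measurability)]
  by_cases hb : b = f a
  · have : (fun y => (y, f y)) ⁻¹' {(a, b)} = {a} := by
      ext y; simp only [Set.mem_preimage, Set.mem_singleton_iff, Prod.mk.injEq]
      constructor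
      · exact fun h => h.1
      · rintro rfl; exact ⟨rfl, hb.symm⟩
    rw [this]; simp [hb]
  · have : (fun y => (y, f y)) ⁻¹' {(a, b)} = ∅ := by
      ext y; simp only [Set.mem_preimage, Set.mem_singleton_iff, Prod.mk.injEq,
        Set.mem_empty_iff_false, iff_false]
      rintro ⟨rfl, h⟩; exact hb h.symm
    rw [this]; simp [hb]

theorem shockFactor_eq (g : ℕ → ℝ) (θ σ : ℝ) (j i : ℤ) :
    shockFactor g θ σ (muN g σ) j i
      = (baseM g θ σ j i).map (fun y => (y, if i = j then y + 1 else y)) := by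
  unfold shockFactor baseM
  rcases lt_trichotomy i j with h | h | h
  · simp only [if_pos h, if_neg h.ne]
    exact siteMeasure_graph (muN g θ) (fun y => y)
  · subst h
    simp only [lt_irrefl, if_false, if_true]
    exact siteMeasure_graph (muN g σ) (fun y => y + 1)
  · simp only [if_neg h.not_gt, if_neg h.ne']
    exact siteMeasure_graph (muN g σ) (fun y => y)

theorem ExpRate.nu_eq (h : ExpRate 𝔞 β g) (θ σ : ℝ) (j : ℤ) (ν : Measure (ConfN × ConfN))
    (hν : IsProductMeasure (shockFactor g θ σ (muN g σ) j) ν) :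
    ν = (baseP g θ σ j).map (fun ω => (ω, inc ω j)) := by
  have := h.prob_base θ σ j
  have hfm : ∀ i : ℤ, Measurable (fun y : ℕ => (y, if i = j then y + 1 else y)) :=
    fun i => measurable_of_countable _
  have : ∀ i, IsProbabilityMeasure
      ((baseM g θ σ j i).map (fun y => (y, if i = j then y + 1 else y))) :=
    fun i => Measure.isProbabilityMeasure_map (hfm i).aemeasurable
  let e : ConfN × ConfN → (ℤ → ℕ × ℕ) := fun x i => (x.1 i, x.2 i)
  let e' : (ℤ → ℕ × ℕ) → ConfN × ConfN := fun z => (fun i => (z i).1, fun i => (z i).2)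
  have he : Measurable e := by fun_prop
  have he' : Measurable e' := by fun_prop
  have key : ν.map e = (baseP g θ σ j).map (fun ω i => (ω i, if i = j then ω i + 1 else ω i)) := by
    rw [baseP, Measure.infinitePi_map_pi (f := fun i y => (y, if i = j then y + 1 else y)) _ hfm]
    refine Measure.eq_infinitePi _ fun s t ht => ?_
    rw [Measure.map_apply he (MeasurableSet.pi s.countable_toSet fun i _ => ht i)]
    have := hν s t
    simp_rw [shockFactor_eq] at this
    rw [← this]
    rfl
  have k2 := congrArg (Measure.map e') key
  rw [Measure.map_map he' he, Measure.map_map he'] at k2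
  · have id1 : e' ∘ e = id := rfl
    rw [id1, Measure.map_id] at k2
    rw [k2]
    congr 1
    funext ω
    simp only [Function.comp, e', Prod.mk.injEq, true_and]
    funext i
    unfold inc
    by_cases hi : i = j
    · subst hi; simp
    · simp [hi]
  · exact measurable_pi_lambda _ fun i => (hfm i).comp (measurable_pi_apply i)

theorem cyl_measurable (φ : ConfN × ConfN → ℝ) (s : Finset ℤ)
    (hs : ∀ x y : ConfN × ConfN, (∀ i ∈ s, x.1 i = y.1 i ∧ x.2 i = y.2 i) → φ x = φ y) :
    Measurable φ := by
  classical
  let r : ConfN × ConfN → (s → ℕ × ℕ) := fun x i => (x.1 i, x.2 i)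
  let u : (s → ℕ × ℕ) → ConfN × ConfN := fun z =>
    (fun i => if h : i ∈ s then (z ⟨i, h⟩).1 else 0, fun i => if h : i ∈ s then (z ⟨i, h⟩).2 else 0)
  have hr : Measurable r := by fun_prop
  have : φ = (fun z => φ (u z)) ∘ r := by
    funext x
    refine hs _ _ fun i hi => ?_
    simp [u, r, hi]
  rw [this]
  exact (measurable_of_countable _).comp hr

theorem sum_Ico_tele (A : ℤ → ℝ) (m n : ℤ) (hmn : m ≤ n) :
    ∑ i ∈ Finset.Ico m n, (A (i+1) - A i) = A n - A m := by
  induction n, hmn using Int.le_induction with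
  | base => simp
  | succ k hk ih =>
    have : Finset.Ico m (k+1) = insert k (Finset.Ico m k) := by
      ext x; simp only [Finset.mem_Ico, Finset.mem_insert]; omega
    rw [this, Finset.sum_insert (by simp), ih]; ring

theorem sum_Ico_shock (A : ℤ → ℝ) (m j n : ℤ) (h1 : m ≤ j) (h2 : j ≤ n) (p q : ℝ) :
    ∑ i ∈ Finset.Ico m n, exp (if i < j then p else q) * (A (i+1) - A i)
      = exp p * (A j - A m) + exp q * (A n - A j) := by
  have hu : Finset.Ico m n = Finset.Ico m j ∪ Finset.Ico j n := by
    ext x; simp only [Finset.mem_Ico, Finset.mem_union]; omega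
  have hd : Disjoint (Finset.Ico m j) (Finset.Ico j n) := by
    rw [Finset.disjoint_left]; intro x; simp only [Finset.mem_Ico]; omega
  rw [hu, Finset.sum_union hd, ← sum_Ico_tele A m j h1, ← sum_Ico_tele A j n h2,
    Finset.mul_sum, Finset.mul_sum]
  congr 1
  · refine Finset.sum_congr rfl fun i hi => ?_
    rw [if_pos (Finset.mem_Ico.1 hi).2]
  · refine Finset.sum_congr rfl fun i hi => ?_
    rw [if_neg (not_lt.2 (Finset.mem_Ico.1 hi).1)]

theorem exists_window (s : Finset ℤ) (j : ℤ) :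
    ∃ m n : ℤ, m ≤ j ∧ j < n ∧ ∀ k ∈ s, m < k ∧ k < n := by
  induction s using Finset.induction_on with
  | empty => exact ⟨j, j+1, le_rfl, by omega, by simp⟩
  | insert a s ha ih =>
    obtain ⟨m, n, h1, h2, h3⟩ := ih
    refine ⟨min m (a-1), max n (a+1), by omega, by omega, ?_⟩
    intro k hk
    rcases Finset.mem_insert.1 hk with rfl | hk
    · omega
    · have := h3 k hk; omega

theorem moveN_of_ne (η : ConfN) {i j k : ℤ} (h1 : k ≠ i) (h2 : k ≠ j) : moveN η i j k = η k := by
  simp [moveN, h1, h2]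

theorem inc_of_ne (η : ConfN) {i k : ℤ} (h : k ≠ i) : inc η i k = η k := by
  simp [inc, h]

theorem inc_self (η : ConfN) (i : ℤ) : inc η i i = η i + 1 := by simp [inc]

theorem moveN_inc_comm (ω : ConfN) (i k j : ℤ) (hki : k ≠ i) (h : ω i ≠ 0) :
    moveN (inc ω j) i k = inc (moveN ω i k) j := by
  funext l
  unfold moveN inc
  by_cases hl : l = j
  · subst hl
    simp only [Function.update_self]
    split_ifs with h1 h2
    · subst h1; omega
    · rfl
    · rfl
  · simp [hl]

theorem LN_eq_sum (g : ℕ → ℝ) (φ : ConfN × ConfN → ℝ) (s : Finset ℤ)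
    (hs : ∀ x y : ConfN × ConfN, (∀ i ∈ s, x.1 i = y.1 i ∧ x.2 i = y.2 i) → φ x = φ y)
    (m n : ℤ) (hmn : ∀ k ∈ s, m < k ∧ k < n) (x : ConfN × ConfN) :
    LN 1 g φ x = ∑ i ∈ Finset.Ico m n,
      (g (x.1 i) * (φ (moveN x.1 i (i + 1), moveN x.2 i (i + 1)) - φ x)
      + (g (x.2 i) - g (x.1 i)) * (φ (x.1, moveN x.2 i (i + 1)) - φ x)) := by
  unfold LN
  simp only [sub_self, zero_mul, add_zero, one_mul]
  refine tsum_eq_sum fun i hi => ?_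
  have hne : ∀ k ∈ s, k ≠ i ∧ k ≠ i + 1 := by
    intro k hk
    have := hmn k hk
    rw [Finset.mem_Ico] at hi
    omega
  have e1 : φ (moveN x.1 i (i + 1), moveN x.2 i (i + 1)) = φ x :=
    hs _ _ fun k hk => ⟨moveN_of_ne _ (hne k hk).1 (hne k hk).2,
      moveN_of_ne _ (hne k hk).1 (hne k hk).2⟩
  have e2 : φ (x.1, moveN x.2 i (i + 1)) = φ x :=
    hs _ _ fun k hk => ⟨rfl, moveN_of_ne _ (hne k hk).1 (hne k hk).2⟩
  rw [e1, e2]; ring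

theorem ExpRate.LN_shock (h : ExpRate 𝔞 β g) (φ : ConfN × ConfN → ℝ) (s : Finset ℤ)
    (hs : ∀ x y : ConfN × ConfN, (∀ i ∈ s, x.1 i = y.1 i ∧ x.2 i = y.2 i) → φ x = φ y)
    (m n j : ℤ) (hmn : ∀ k ∈ s, m < k ∧ k < n) (h1 : m ≤ j) (h2 : j < n) (ω : ConfN) :
    LN 1 g φ (ω, inc ω j) = (∑ i ∈ Finset.Ico m n,
      (g (ω i) * φ (moveN ω i (i+1), inc (moveN ω i (i+1)) j) - g (ω i) * φ (ω, inc ω j)))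
      + (exp β - 1) * ((g (ω j) + 𝔞) * φ (ω, inc ω (j+1)) -
          (g (ω j) + 𝔞) * φ (ω, inc ω j)) := by
  rw [LN_eq_sum g φ s hs m n hmn, Finset.sum_add_distrib]
  congr 1
  · refine Finset.sum_congr rfl fun i _ => ?_
    by_cases h0 : ω i = 0
    · simp [h0, h.zero]
    · simp only
      rw [moveN_inc_comm ω i (i+1) j (by omega) h0]; ring
  · rw [Finset.sum_eq_single j]
    · simp only
      rw [moveN_inc ω j (j+1) (by omega), inc_self]
      have : g (ω j + 1) - g (ω j) = (exp β - 1) * (g (ω j) + 𝔞) := by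
        rw [h.hg, h.hg]
        push_cast
        rw [mul_add, mul_one, exp_add]; ring
      rw [this]; ring
    · intro i _ hi
      simp only
      rw [inc_of_ne ω hi]; ring
    · intro hj
      exact absurd (Finset.mem_Ico.2 ⟨h1, h2⟩) hj

theorem ExpRate.main (h : ExpRate 𝔞 β g) {θ σ : ℝ} (hσ : σ = θ - β)
    (ν : ℤ → Measure (ConfN × ConfN))
    (hν : ∀ j : ℤ, IsProductMeasure (shockFactor g θ σ (muN g σ) j) (ν j))
    (j : ℤ) (φ : ConfN × ConfN → ℝ) (hφ : IsBddCylinder φ) :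
    ∫ x, LN 1 g φ x ∂(ν j)
      = (exp β - 1) * (exp σ + 𝔞) * ((∫ x, φ x ∂(ν (j + 1))) - ∫ x, φ x ∂(ν j)) := by
  obtain ⟨⟨s, hs⟩, C, hC⟩ := hφ
  obtain ⟨m, n, h1, h2, hmn⟩ := exists_window s j
  have hm : Measurable φ := cyl_measurable φ s hs
  have hT : ∀ k : ℤ, Measurable (fun ω : ConfN => (ω, inc ω k)) := fun k => by fun_prop
  have hgm : Measurable g := measurable_of_countable g
  have hmv : ∀ i : ℤ, Measurable (fun ω : ConfN => moveN ω i (i+1)) :=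
    fun i => measurable_moveN i (i+1)
  have hL : Measurable (LN 1 g φ) := by
    have : LN 1 g φ = fun x => ∑ i ∈ Finset.Ico m n,
      (g (x.1 i) * (φ (moveN x.1 i (i + 1), moveN x.2 i (i + 1)) - φ x)
      + (g (x.2 i) - g (x.1 i)) * (φ (x.1, moveN x.2 i (i + 1)) - φ x)) :=
      funext fun x => LN_eq_sum g φ s hs m n hmn x
    rw [this]
    refine Finset.measurable_sum _ fun i _ => ?_
    have a1 : Measurable fun x : ConfN × ConfN => φ (moveN x.1 i (i + 1), moveN x.2 i (i + 1)) :=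
      hm.comp (((hmv i).comp measurable_fst).prodMk ((hmv i).comp measurable_snd))
    have a2 : Measurable fun x : ConfN × ConfN => φ (x.1, moveN x.2 i (i + 1)) :=
      hm.comp (measurable_fst.prodMk ((hmv i).comp measurable_snd))
    fun_prop
  rw [h.nu_eq θ σ j _ (hν j), h.nu_eq θ σ (j+1) _ (hν (j+1)),
    integral_map (hT j).aemeasurable hL.aestronglyMeasurable,
    integral_map (hT j).aemeasurable hm.aestronglyMeasurable,
    integral_map (hT (j+1)).aemeasurable hm.aestronglyMeasurable]
  simp_rw [h.LN_shock φ s hs m n j hmn h1 h2]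
  set ψ : ConfN → ℝ := fun ω => φ (ω, inc ω j) with hψ
  have hψm : Measurable ψ := hm.comp (hT j)
  have hχm : Measurable (fun ω => φ (ω, inc ω (j+1))) := hm.comp (hT (j+1))
  have hmvm : ∀ i : ℤ, Measurable (fun ω => ψ (moveN ω i (i+1))) := fun i => hψm.comp (hmv i)
  have I1 : ∀ i, Integrable (fun ω => g (ω i) * ψ (moveN ω i (i+1))) (baseP g θ σ j) :=
    fun i => h.base_integrable_g θ σ j i _ (hmvm i) C (fun _ => hC _)
  have I2 : ∀ i, Integrable (fun ω => g (ω i) * ψ ω) (baseP g θ σ j) :=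
    fun i => h.base_integrable_g θ σ j i _ hψm C (fun _ => hC _)
  have I3 : Integrable ψ (baseP g θ σ j) := h.base_integrable_bdd θ σ j _ hψm C (fun _ => hC _)
  have I4 : Integrable (fun ω => (g (ω j) + 𝔞) * ψ ω) (baseP g θ σ j) := by
    simp_rw [add_mul]
    exact (I2 j).add (I3.const_mul 𝔞)
  have I5 : Integrable (fun ω => (g (ω j) + 𝔞) * φ (ω, inc ω (j+1))) (baseP g θ σ j) := by
    simp_rw [add_mul]
    exact (h.base_integrable_g θ σ j j _ hχm C (fun _ => hC _)).add
      ((h.base_integrable_bdd θ σ j _ hχm C (fun _ => hC _)).const_mul 𝔞)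
  set A : ℤ → ℝ := fun k => ∫ ω, ψ (inc ω k) ∂(baseP g θ σ j) with hA
  have hout : ∀ k, k ∉ s → A k = ∫ ω, ψ ω ∂(baseP g θ σ j) := by
    intro k hk
    simp only [hA]
    congr 1
    funext ω
    refine hs _ _ fun i hi => ?_
    have hik : i ≠ k := fun e => hk (e ▸ hi)
    refine ⟨inc_of_ne _ hik, ?_⟩
    by_cases hij : i = j
    · subst hij; simp only [inc_self, inc_of_ne _ hik]
    · simp only [inc_of_ne _ hij, inc_of_ne _ hik]
  have hAm : A m = ∫ ω, ψ ω ∂(baseP g θ σ j) :=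
    hout m (fun hm' => by have := hmn m hm'; omega)
  have hAn : A n = ∫ ω, ψ ω ∂(baseP g θ σ j) :=
    hout n (fun hm' => by have := hmn n hm'; omega)
  have Jterm : ∀ i, ∫ ω, (g (ω i) * ψ (moveN ω i (i+1)) - g (ω i) * ψ ω) ∂(baseP g θ σ j)
      = exp (if i < j then θ else σ) * (A (i+1) - A i) := by
    intro i
    rw [integral_sub (I1 i) (I2 i), h.base_g θ σ j i _ (hmvm i) C (fun _ => hC _),
      h.base_g θ σ j i _ hψm C (fun _ => hC _), mul_sub]
    simp only [moveN_inc _ i (i+1) (by omega : i + 1 ≠ i), hA]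
  have J4 : ∫ ω, (g (ω j) + 𝔞) * ψ ω ∂(baseP g θ σ j) = exp σ * A j + 𝔞 * A m := by
    simp_rw [add_mul]
    rw [integral_add (I2 j) (I3.const_mul 𝔞), h.base_g θ σ j j _ hψm C (fun _ => hC _),
      integral_const_mul, hAm]
    simp [hA]
  have J5 := h.base_theta hσ j _ hχm C (fun _ => hC _)
  have e1 : ∫ ω, ((∑ i ∈ Finset.Ico m n, (g (ω i) * ψ (moveN ω i (i+1)) - g (ω i) * ψ ω))
      + (exp β - 1) * ((g (ω j) + 𝔞) * φ (ω, inc ω (j+1)) - (g (ω j) + 𝔞) * ψ ω))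
        ∂(baseP g θ σ j)
      = (∑ i ∈ Finset.Ico m n, exp (if i < j then θ else σ) * (A (i+1) - A i))
        + (exp β - 1) * ((exp σ + 𝔞) * ∫ ω, φ (ω, inc ω (j+1)) ∂(baseP g θ σ (j+1))
          - (exp σ * A j + 𝔞 * A m)) := by
    have I6 : ∀ i, Integrable (fun ω => g (ω i) * ψ (moveN ω i (i+1)) - g (ω i) * ψ ω)
        (baseP g θ σ j) := fun i => (I1 i).sub (I2 i)
    have I7 : Integrable (fun ω => (exp β - 1) * ((g (ω j) + 𝔞) * φ (ω, inc ω (j+1))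
        - (g (ω j) + 𝔞) * ψ ω)) (baseP g θ σ j) := (I5.sub I4).const_mul _
    rw [integral_add (integrable_finsetSum _ fun i _ => I6 i) I7,
      integral_finsetSum _ fun i _ => I6 i,
      integral_const_mul, integral_sub I5 I4, J4, J5]
    congr 1
    exact Finset.sum_congr rfl fun i _ => Jterm i
  refine e1.trans ?_
  rw [sum_Ico_shock A m j n h1 h2.le, hAn, hAm]
  have hθ : exp θ = exp σ * exp β := by rw [← exp_add]; congr 1; rw [hσ]; ring
  rw [hθ]
  ring

end ZRPaux

/-- Case (iii) of Theorem 1: the convex exponential zero range process on ℕ. For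
`g(y) = 𝔞·(e^{βy} - 1)`, `p = 1`, `σ = θ - β` and `μ̂ = μ^σ`, the single-shock measure
satisfies the random walking shock property with rates `P = (e^β - 1)·(e^σ + 𝔞)` and `Q = 0`. -/
theorem rws_exponential_ZRP
    (𝔞 β θ σ : ℝ) (h𝔞 : 0 < 𝔞) (hβ : 0 < β) (hσ : σ = θ - β)
    (g : ℕ → ℝ) (hg : ∀ y : ℕ, g y = 𝔞 * (exp (β * y) - 1))
    (ν : ℤ → Measure (ConfN × ConfN))
    (hν : ∀ j : ℤ, IsProductMeasure (shockFactor g θ σ (muN g σ) j) (ν j))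
    (j : ℤ) (φ : ConfN × ConfN → ℝ) (hφ : IsBddCylinder φ) :
    ∫ x, LN 1 g φ x ∂(ν j)
      = (exp β - 1) * (exp σ + 𝔞) * ((∫ x, φ x ∂(ν (j + 1))) - ∫ x, φ x ∂(ν j)) := by
  exact ExpRate.main ⟨h𝔞, hβ, hg⟩ hσ ν hν j φ hφ
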